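/- arXiv:math/0412065 — 2 statements merged into one kernel-verified Lean document; each statement's English description precedes it below -/
import Mathlib

section
/- For all z₁, z₂, z₃ ∈ ℂ, the following Jacobian identities hold: (C₆, C₉, C₁₂) = −2⁵·3⁴·𝔠₁₂²; (C₆, C₉, C₁₈) = −2⁴·3⁵·C₆·𝔠₁₂²; (C₆, C₁₂, C₁₈) = 2⁹·3⁷·C₉·𝔠₁₂²; (C₉, C₁₂, C₁₈) = 2⁴·3⁵·(C₆² − C₁₂)·𝔠₁₂². -/
noncomputable section

/-- Hessian invariant C₆. -/
def C₆ : ℂ → ℂ → ℂ → ℂ := fun z₁ z₂ z₃ =>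
  z₁^6 + z₂^6 + z₃^6 - 10*(z₁^3*z₂^3 + z₂^3*z₃^3 + z₃^3*z₁^3)
/-- Hessian invariant C₉. -/
def C₉ : ℂ → ℂ → ℂ → ℂ := fun z₁ z₂ z₃ =>
  (z₁^3 - z₂^3)*(z₂^3 - z₃^3)*(z₃^3 - z₁^3)
/-- Hessian invariant C₁₂. -/
def C₁₂ : ℂ → ℂ → ℂ → ℂ := fun z₁ z₂ z₃ =>
  (z₁^3 + z₂^3 + z₃^3)*((z₁^3 + z₂^3 + z₃^3)^3 + 216*z₁^3*z₂^3*z₃^3)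
/-- Hessian invariant 𝔠₁₂. -/
def 𝔠₁₂ : ℂ → ℂ → ℂ → ℂ := fun z₁ z₂ z₃ =>
  z₁*z₂*z₃*(27*z₁^3*z₂^3*z₃^3 - (z₁^3 + z₂^3 + z₃^3)^3)
/-- Hessian invariant C₁₈. -/
def C₁₈ : ℂ → ℂ → ℂ → ℂ := fun z₁ z₂ z₃ =>
  (z₁^3 + z₂^3 + z₃^3)^6 - 540*z₁^3*z₂^3*z₃^3*(z₁^3 + z₂^3 + z₃^3)^3 - 5832*z₁^6*z₂^6*z₃^6

/-- Complex partial derivative in the first variable. -/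
def pd₁ (F : ℂ → ℂ → ℂ → ℂ) (z₁ z₂ z₃ : ℂ) : ℂ := deriv (fun t => F t z₂ z₃) z₁
/-- Complex partial derivative in the second variable. -/
def pd₂ (F : ℂ → ℂ → ℂ → ℂ) (z₁ z₂ z₃ : ℂ) : ℂ := deriv (fun t => F z₁ t z₃) z₂
/-- Complex partial derivative in the third variable. -/
def pd₃ (F : ℂ → ℂ → ℂ → ℂ) (z₁ z₂ z₃ : ℂ) : ℂ := deriv (fun t => F z₁ z₂ t) z₃

/-- Jacobian determinant of three functions of (z₁, z₂, z₃). -/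
def jac (F G H : ℂ → ℂ → ℂ → ℂ) (z₁ z₂ z₃ : ℂ) : ℂ :=
  Matrix.det !![pd₁ F z₁ z₂ z₃, pd₂ F z₁ z₂ z₃, pd₃ F z₁ z₂ z₃;
                pd₁ G z₁ z₂ z₃, pd₂ G z₁ z₂ z₃, pd₃ G z₁ z₂ z₃;
                pd₁ H z₁ z₂ z₃, pd₂ H z₁ z₂ z₃, pd₃ H z₁ z₂ z₃]

/-- For a function invariant under cyclic permutation of the variables, the second partial
derivative is the first one at the permuted point. -/
lemma pd₂_eq_pd₁_of_cyclic {F : ℂ → ℂ → ℂ → ℂ} (hF : ∀ x y z, F x y z = F y z x) (x y z : ℂ) :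
    pd₂ F x y z = pd₁ F y z x := by
  simp only [pd₁, pd₂]
  exact congrArg (deriv · y) (funext fun t => hF x t z)

/-- For a function invariant under cyclic permutation of the variables, the third partial
derivative is the first one at the permuted point. -/
lemma pd₃_eq_pd₁_of_cyclic {F : ℂ → ℂ → ℂ → ℂ} (hF : ∀ x y z, F x y z = F y z x) (x y z : ℂ) :
    pd₃ F x y z = pd₁ F z x y := by
  simp only [pd₁, pd₃]
  exact congrArg (deriv · z) (funext fun t => (hF t x y).symm)

/-- The Jacobian determinant of three cyclically invariant functions, in terms of their first
partial derivatives. -/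
lemma jac_of_cyclic {F G H : ℂ → ℂ → ℂ → ℂ} (hF : ∀ x y z, F x y z = F y z x)
    (hG : ∀ x y z, G x y z = G y z x) (hH : ∀ x y z, H x y z = H y z x) (x y z : ℂ) :
    jac F G H x y z = Matrix.det !![pd₁ F x y z, pd₁ F y z x, pd₁ F z x y;
                                    pd₁ G x y z, pd₁ G y z x, pd₁ G z x y;
                                    pd₁ H x y z, pd₁ H y z x, pd₁ H z x y] := by
  simp only [jac, pd₂_eq_pd₁_of_cyclic hF, pd₂_eq_pd₁_of_cyclic hG, pd₂_eq_pd₁_of_cyclic hH,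
    pd₃_eq_pd₁_of_cyclic hF, pd₃_eq_pd₁_of_cyclic hG, pd₃_eq_pd₁_of_cyclic hH]

lemma C₆_cyclic (x y z : ℂ) : C₆ x y z = C₆ y z x := by
  simp only [C₆]; ring

lemma C₉_cyclic (x y z : ℂ) : C₉ x y z = C₉ y z x := by
  simp only [C₉]; ring

lemma C₁₂_cyclic (x y z : ℂ) : C₁₂ x y z = C₁₂ y z x := by
  simp only [C₁₂]; ring

lemma C₁₈_cyclic (x y z : ℂ) : C₁₈ x y z = C₁₈ y z x := by
  simp only [C₁₈]; ring

lemma hasDerivAt_cube_add_add (x y z : ℂ) :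
    HasDerivAt (fun t : ℂ => t ^ 3 + y ^ 3 + z ^ 3) (3 * x ^ 2) x := by
  simpa using ((hasDerivAt_pow 3 x).add_const (y ^ 3)).add_const (z ^ 3)

lemma hasDerivAt_cube_mul_mul (x y z : ℂ) :
    HasDerivAt (fun t : ℂ => t ^ 3 * y ^ 3 * z ^ 3) (3 * x ^ 2 * y ^ 3 * z ^ 3) x := by
  simpa using ((hasDerivAt_pow 3 x).mul_const (y ^ 3)).mul_const (z ^ 3)

lemma pd₁_C₆ (x y z : ℂ) : pd₁ C₆ x y z = 3 * x ^ 2 * (2 * x ^ 3 - 10 * (y ^ 3 + z ^ 3)) := by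
  have h := ((hasDerivAt_cube_add_add x y z).pow 2).sub
    ((((hasDerivAt_pow 3 x).mul_const (y ^ 3 + z ^ 3)).add_const (y ^ 3 * z ^ 3)).const_mul 12)
  refine HasDerivAt.deriv ((h.congr_deriv ?_).congr_of_eventuallyEq (.of_forall fun t => ?_))
  · push_cast; ring
  · simp only [C₆, Pi.sub_apply, Pi.pow_apply]; ring

lemma pd₁_C₉ (x y z : ℂ) :
    pd₁ C₉ x y z = 3 * x ^ 2 * ((y ^ 3 - z ^ 3) * (y ^ 3 + z ^ 3 - 2 * x ^ 3)) := by
  have h := (((hasDerivAt_pow 3 x).sub_const (y ^ 3)).mul_const (y ^ 3 - z ^ 3)).mul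
    ((hasDerivAt_pow 3 x).const_sub (z ^ 3))
  refine HasDerivAt.deriv (h.congr_deriv ?_)
  push_cast; ring

lemma pd₁_C₁₂ (x y z : ℂ) :
    pd₁ C₁₂ x y z = 3 * x ^ 2 * (4 * (x ^ 3 + y ^ 3 + z ^ 3) ^ 3 + 216 * (x ^ 3 * y ^ 3 * z ^ 3)
      + 216 * (x ^ 3 + y ^ 3 + z ^ 3) * (y ^ 3 * z ^ 3)) := by
  have hs := hasDerivAt_cube_add_add x y z
  have h := hs.mul ((hs.pow 3).add ((hasDerivAt_cube_mul_mul x y z).const_mul 216))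
  refine HasDerivAt.deriv ((h.congr_deriv ?_).congr_of_eventuallyEq (.of_forall fun t => ?_))
  · simp only [Pi.add_apply, Pi.pow_apply]; push_cast; ring
  · simp only [C₁₂, Pi.add_apply, Pi.mul_apply, Pi.pow_apply]; ring

lemma pd₁_C₁₈ (x y z : ℂ) :
    pd₁ C₁₈ x y z = 3 * x ^ 2 * (6 * (x ^ 3 + y ^ 3 + z ^ 3) ^ 5
      - 1620 * (x ^ 3 * y ^ 3 * z ^ 3) * (x ^ 3 + y ^ 3 + z ^ 3) ^ 2
      - (540 * (x ^ 3 + y ^ 3 + z ^ 3) ^ 3 + 11664 * (x ^ 3 * y ^ 3 * z ^ 3))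
        * (y ^ 3 * z ^ 3)) := by
  have hs := hasDerivAt_cube_add_add x y z
  have hq := hasDerivAt_cube_mul_mul x y z
  have h := ((hs.pow 6).sub ((hq.const_mul 540).mul (hs.pow 3))).sub ((hq.pow 2).const_mul 5832)
  refine HasDerivAt.deriv ((h.congr_deriv ?_).congr_of_eventuallyEq (.of_forall fun t => ?_))
  · simp only [Pi.pow_apply]; push_cast; ring
  · simp only [C₁₈, Pi.sub_apply, Pi.mul_apply, Pi.pow_apply]; ring

theorem jacobian_identities_I (z₁ z₂ z₃ : ℂ) :
    jac C₆ C₉ C₁₂ z₁ z₂ z₃ = -(2^5 * 3^4) * (𝔠₁₂ z₁ z₂ z₃)^2 ∧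
    jac C₆ C₉ C₁₈ z₁ z₂ z₃ = -(2^4 * 3^5) * C₆ z₁ z₂ z₃ * (𝔠₁₂ z₁ z₂ z₃)^2 ∧
    jac C₆ C₁₂ C₁₈ z₁ z₂ z₃ = 2^9 * 3^7 * C₉ z₁ z₂ z₃ * (𝔠₁₂ z₁ z₂ z₃)^2 ∧
    jac C₉ C₁₂ C₁₈ z₁ z₂ z₃
      = 2^4 * 3^5 * ((C₆ z₁ z₂ z₃)^2 - C₁₂ z₁ z₂ z₃) * (𝔠₁₂ z₁ z₂ z₃)^2 := by
  refine ⟨?_, ?_, ?_, ?_⟩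
  · rw [jac_of_cyclic C₆_cyclic C₉_cyclic C₁₂_cyclic, Matrix.det_fin_three]
    simp [pd₁_C₆, pd₁_C₉, pd₁_C₁₂, 𝔠₁₂]
    ring
  · rw [jac_of_cyclic C₆_cyclic C₉_cyclic C₁₈_cyclic, Matrix.det_fin_three]
    simp [pd₁_C₆, pd₁_C₉, pd₁_C₁₈, C₆, 𝔠₁₂]
    ring
  · rw [jac_of_cyclic C₆_cyclic C₁₂_cyclic C₁₈_cyclic, Matrix.det_fin_three]
    simp [pd₁_C₆, pd₁_C₁₂, pd₁_C₁₈, C₉, 𝔠₁₂]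
    ring
  · rw [jac_of_cyclic C₉_cyclic C₁₂_cyclic C₁₈_cyclic, Matrix.det_fin_three]
    simp [pd₁_C₉, pd₁_C₁₂, pd₁_C₁₈, C₆, C₁₂, 𝔠₁₂]
    ring
end
end

section
/- For all z₁, z₂, z₃ ∈ ℂ, the following Hessian determinant identities hold, where Hessian(F) denotes the determinant of the 3×3 matrix of second partial derivatives ∂²F/∂zᵢ∂zⱼ: (i) Hessian(C₆) = −108000·𝔠₁₂, where C₆ = z₁⁶+z₂⁶+z₃⁶−10(z₁³z₂³+z₂³z₃³+z₃³z₁³) and 𝔠₁₂ = z₁z₂z₃(27 z₁³z₂³z₃³ − (z₁³+z₂³+z₃³)³); (ii) Hessian(H) = −216·K and (iii) Hessian(K) = −54·K, where H = (z₁³+z₂³+z₃³) + 6·z₁z₂z₃ and K = (z₁³+z₂³+z₃³) − 3·z₁z₂z₃. -/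
noncomputable section

/-- Hessian determinant of a function of (z₁, z₂, z₃): the determinant of the matrix of
second partial derivatives. -/
def hessianDet (F : ℂ → ℂ → ℂ → ℂ) (z₁ z₂ z₃ : ℂ) : ℂ :=
  Matrix.det !![pd₁ (pd₁ F) z₁ z₂ z₃, pd₁ (pd₂ F) z₁ z₂ z₃, pd₁ (pd₃ F) z₁ z₂ z₃;
                pd₂ (pd₁ F) z₁ z₂ z₃, pd₂ (pd₂ F) z₁ z₂ z₃, pd₂ (pd₃ F) z₁ z₂ z₃;
                pd₃ (pd₁ F) z₁ z₂ z₃, pd₃ (pd₂ F) z₁ z₂ z₃, pd₃ (pd₃ F) z₁ z₂ z₃]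

theorem deriv_sextic (a b c d e f : ℂ) (t : ℂ) :
    deriv (fun t => a * t ^ 6 + b * t ^ 5 + c * t ^ 3 + d * t ^ 2 + e * t + f) t =
      6 * a * t ^ 5 + 5 * b * t ^ 4 + 3 * c * t ^ 2 + 2 * d * t + e := by
  have h (k : ℂ) (n : ℕ) : HasDerivAt (fun t => k * t ^ n) (k * (n * t ^ (n - 1))) t :=
    (hasDerivAt_pow n t).const_mul k
  refine (((((((h a 6).add (h b 5)).add (h c 3)).add (h d 2)).add
    ((hasDerivAt_id' t).const_mul e)).add_const f).congr_deriv ?_).deriv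
  push_cast
  ring

theorem deriv_eq_of_eq_sextic {g : ℂ → ℂ} (a b c d e f : ℂ)
    (hg : ∀ t, g t = a * t ^ 6 + b * t ^ 5 + c * t ^ 3 + d * t ^ 2 + e * t + f) (t : ℂ) :
    deriv g t = 6 * a * t ^ 5 + 5 * b * t ^ 4 + 3 * c * t ^ 2 + 2 * d * t + e := by
  rw [funext hg, deriv_sextic]

/-- The Hessian determinant of a member of the Hesse pencil of cubics. -/
theorem hessianDet_hesse_pencil (a x y z : ℂ) :
    hessianDet (fun x y z => (x ^ 3 + y ^ 3 + z ^ 3) + a * (x * y * z)) x y z =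
      (216 + 2 * a ^ 3) * (x * y * z) - 6 * a ^ 2 * (x ^ 3 + y ^ 3 + z ^ 3) := by
  have h₁ : pd₁ (fun x y z => (x ^ 3 + y ^ 3 + z ^ 3) + a * (x * y * z)) =
      fun x y z => 3 * x ^ 2 + a * (y * z) := by
    funext x y z
    refine (deriv_eq_of_eq_sextic 0 0 1 0 (a * (y * z)) (y ^ 3 + z ^ 3) ?_ x).trans ?_
    · intro t; ring
    · ring
  have h₂ : pd₂ (fun x y z => (x ^ 3 + y ^ 3 + z ^ 3) + a * (x * y * z)) =
      fun x y z => 3 * y ^ 2 + a * (x * z) := by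
    funext x y z
    refine (deriv_eq_of_eq_sextic 0 0 1 0 (a * (x * z)) (x ^ 3 + z ^ 3) ?_ y).trans ?_
    · intro t; ring
    · ring
  have h₃ : pd₃ (fun x y z => (x ^ 3 + y ^ 3 + z ^ 3) + a * (x * y * z)) =
      fun x y z => 3 * z ^ 2 + a * (x * y) := by
    funext x y z
    refine (deriv_eq_of_eq_sextic 0 0 1 0 (a * (x * y)) (x ^ 3 + y ^ 3) ?_ z).trans ?_
    · intro t; ring
    · ring
  have hsq (k b t : ℂ) : deriv (fun t => k * t ^ 2 + b) t = 2 * k * t := by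
    refine (deriv_eq_of_eq_sextic 0 0 0 k 0 b ?_ t).trans ?_
    · intro t; ring
    · ring
  have hleft (k b t : ℂ) : deriv (fun t => k + a * (t * b)) t = a * b := by
    refine (deriv_eq_of_eq_sextic 0 0 0 0 (a * b) k ?_ t).trans ?_
    · intro t; ring
    · ring
  have hright (k b t : ℂ) : deriv (fun t => k + a * (b * t)) t = a * b := by
    simpa only [mul_comm] using hleft k b t
  rw [hessianDet, h₁, h₂, h₃]
  simp only [pd₁, pd₂, pd₃, hsq, hleft, hright, Matrix.det_fin_three,
    Matrix.of_apply, Matrix.cons_val]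
  ring

/-- The Hessian determinant of the sextic invariant of the Hessian group. -/
theorem hessianDet_C₆ (x y z : ℂ) : hessianDet C₆ x y z = -108000 * 𝔠₁₂ x y z := by
  have h₁ : pd₁ C₆ = fun x y z => 6 * x ^ 5 - 30 * x ^ 2 * (y ^ 3 + z ^ 3) := by
    funext x y z
    refine (deriv_eq_of_eq_sextic 1 0 (-10 * (y ^ 3 + z ^ 3)) 0 0
      (y ^ 6 + z ^ 6 - 10 * (y ^ 3 * z ^ 3)) ?_ x).trans ?_
    · intro t; simp only [C₆]; ring
    · ring
  have h₂ : pd₂ C₆ = fun x y z => 6 * y ^ 5 - 30 * y ^ 2 * (x ^ 3 + z ^ 3) := by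
    funext x y z
    refine (deriv_eq_of_eq_sextic 1 0 (-10 * (x ^ 3 + z ^ 3)) 0 0
      (x ^ 6 + z ^ 6 - 10 * (x ^ 3 * z ^ 3)) ?_ y).trans ?_
    · intro t; simp only [C₆]; ring
    · ring
  have h₃ : pd₃ C₆ = fun x y z => 6 * z ^ 5 - 30 * z ^ 2 * (x ^ 3 + y ^ 3) := by
    funext x y z
    refine (deriv_eq_of_eq_sextic 1 0 (-10 * (x ^ 3 + y ^ 3)) 0 0
      (x ^ 6 + y ^ 6 - 10 * (x ^ 3 * y ^ 3)) ?_ z).trans ?_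
    · intro t; simp only [C₆]; ring
    · ring
  have hdiag (s t : ℂ) :
      deriv (fun t => 6 * t ^ 5 - 30 * t ^ 2 * s) t = 30 * t ^ 4 - 60 * t * s := by
    refine (deriv_eq_of_eq_sextic 0 6 0 (-30 * s) 0 0 ?_ t).trans ?_
    · intro t; ring
    · ring
  have hleft (k b s t : ℂ) : deriv (fun t => k - b * (t ^ 3 + s)) t = -3 * b * t ^ 2 := by
    refine (deriv_eq_of_eq_sextic 0 0 (-b) 0 0 (k - b * s) ?_ t).trans ?_
    · intro t; ring
    · ring
  have hright (k b s t : ℂ) : deriv (fun t => k - b * (s + t ^ 3)) t = -3 * b * t ^ 2 := by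
    simpa only [add_comm] using hleft k b s t
  rw [hessianDet, h₁, h₂, h₃]
  simp only [pd₁, pd₂, pd₃, hdiag, hleft, hright, Matrix.det_fin_three,
    Matrix.of_apply, Matrix.cons_val, 𝔠₁₂]
  ring

theorem hessian_determinants (z₁ z₂ z₃ : ℂ)
    (H K : ℂ → ℂ → ℂ → ℂ)
    (hH : H = fun x y z => (x^3 + y^3 + z^3) + 6*(x*y*z))
    (hK : K = fun x y z => (x^3 + y^3 + z^3) - 3*(x*y*z)) :
    hessianDet C₆ z₁ z₂ z₃ = -108000 * 𝔠₁₂ z₁ z₂ z₃ ∧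
    hessianDet H z₁ z₂ z₃ = -216 * K z₁ z₂ z₃ ∧
    hessianDet K z₁ z₂ z₃ = -54 * K z₁ z₂ z₃ := by
  subst hH hK
  refine ⟨hessianDet_C₆ z₁ z₂ z₃, ?_, ?_⟩
  · rw [hessianDet_hesse_pencil]
    ring
  · simp only [sub_eq_add_neg, ← neg_mul]
    rw [hessianDet_hesse_pencil]
    ring
end
end
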